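/- Let s be a vertex, and a, b nonadjacent to s, with A = R_{sa} and B = R_{sb} the minimal sa-tight and sb-tight sets, where κ(s,a) ≥ κ(s,b). Then at least one of the following holds: (i) A ⊆ B; (ii) R_{as} ⊆ A* ∩ B and R_{bs} ⊆ B* ∩ A; (iii) a ∈ ∂B or b ∈ ∂A. -/

import Mathlib

open Set

variable {V : Type*} [Fintype V] [DecidableEq V]

/-- The boundary (neighborhood) of a vertex set: vertices outside `A` adjacent to `A`. -/
def bdry (G : SimpleGraph V) (A : Set V) : Set V := {v | v ∉ A ∧ ∃ a ∈ A, G.Adj a v}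

/-- The "node complement" `A* = V \ (A ∪ ∂A)`. -/
def nstar (G : SimpleGraph V) (A : Set V) : Set V := (A ∪ bdry G A)ᶜ

/-- `C` is a vertex set separating `s` from `t`. -/
def IsSep (G : SimpleGraph V) (s t : V) (C : Set V) : Prop :=
  s ∉ C ∧ t ∉ C ∧ ∀ p : G.Walk s t, ∃ v ∈ C, v ∈ p.support

/-- `κ(s,t)`: minimum size of an `s`–`t` vertex cut. -/
noncomputable def kappa (G : SimpleGraph V) (s t : V) : ℕ :=
  sInf {n | ∃ C : Set V, C.ncard = n ∧ IsSep G s t C}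

/-- A set is tight if `|∂A| = k` and `A* ≠ ∅`. -/
def Tight (G : SimpleGraph V) (k : ℕ) (A : Set V) : Prop :=
  (bdry G A).ncard = k ∧ (nstar G A).Nonempty

/-- A set is small if `|A| ≤ (n - k)/2`. -/
def SmallSet (k : ℕ) (A : Set V) : Prop := 2 * A.ncard + k ≤ Fintype.card V

/-- `G` is `k`-connected. -/
def KConn (G : SimpleGraph V) (k : ℕ) : Prop :=
  k + 1 ≤ Fintype.card V ∧
    ∀ s t : V, s ≠ t → ∀ C : Set V, IsSep G s t C → k ≤ C.ncard

/-- degree of a vertex -/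
noncomputable def deg (G : SimpleGraph V) (v : V) : ℕ := (G.neighborSet v).ncard

/-- `X` is an `st`-tight set: `s ∈ X`, `t ∈ X*` and `|∂X| = κ(s,t)`. -/
def TightST (G : SimpleGraph V) (s t : V) (X : Set V) : Prop :=
  s ∈ X ∧ t ∈ nstar G X ∧ (bdry G X).ncard = kappa G s t

/-- `R_s`: intersection of all small tight sets containing `s`. -/
def Rmin (G : SimpleGraph V) (k : ℕ) (s : V) : Set V :=
  ⋂₀ {A : Set V | Tight G k A ∧ SmallSet k A ∧ s ∈ A}

/-- Two sets are laminar if disjoint or one contains the other. -/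
def Laminar (X Y : Set V) : Prop := Disjoint X Y ∨ X ⊆ Y ∨ Y ⊆ X

/-- `d`-degeneracy: every nonempty vertex subset has a vertex with at most `d`
neighbors inside it. -/
def Degenerate (G : SimpleGraph V) (d : ℕ) : Prop :=
  ∀ W : Set V, W.Nonempty → ∃ v ∈ W, (G.neighborSet v ∩ W).ncard ≤ d

/-- The set of vertices reachable from `s` avoiding `C`. -/
def Reach (G : SimpleGraph V) (C : Set V) (s : V) : Set V :=
  {v | ∃ p : G.Walk s v, ∀ u ∈ p.support, u ∉ C}

theorem mem_bdry {W : Type*} {G : SimpleGraph W} {A : Set W} {v : W} :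
    v ∈ bdry G A ↔ v ∉ A ∧ ∃ u ∈ A, G.Adj u v := Iff.rfl

theorem mem_nstar {W : Type*} {G : SimpleGraph W} {A : Set W} {v : W} :
    v ∈ nstar G A ↔ v ∉ A ∧ ∀ u ∈ A, ¬ G.Adj u v := by
  simp only [nstar, mem_compl_iff, mem_union, mem_bdry]
  grind

theorem mem_nstar_of_notMem {W : Type*} {G : SimpleGraph W} {A : Set W} {v : W}
    (h₁ : v ∉ A) (h₂ : v ∉ bdry G A) : v ∈ nstar G A := by
  simp [nstar, h₁, h₂]

theorem nstar_anti {W : Type*} (G : SimpleGraph W) {A B : Set W} (h : A ⊆ B) :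
    nstar G B ⊆ nstar G A := fun _ hv =>
  mem_nstar.2 ⟨fun hA => (mem_nstar.1 hv).1 (h hA), fun u hu => (mem_nstar.1 hv).2 u (h hu)⟩

theorem mem_nstar_union {W : Type*} {G : SimpleGraph W} {A B : Set W} {v : W}
    (hA : v ∈ nstar G A) (hB : v ∈ nstar G B) : v ∈ nstar G (A ∪ B) := by
  simp only [mem_nstar, mem_union] at *
  grind

/-- A vertex set is contained in the node complement of its node complement. -/
theorem subset_nstar_nstar {W : Type*} (G : SimpleGraph W) (A : Set W) : A ⊆ nstar G (nstar G A) :=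
  fun v hv => mem_nstar.2
    ⟨fun h => (mem_nstar.1 h).1 hv, fun _ hu h => (mem_nstar.1 hu).2 v hv h.symm⟩

/-- A walk leaving `X` meets the boundary of `X`. -/
theorem exists_mem_bdry_support {W : Type*} {G : SimpleGraph W} {X : Set W} {s t : W} (p : G.Walk s t)
    (hs : s ∈ X) (ht : t ∉ X) : ∃ v ∈ bdry G X, v ∈ p.support := by
  obtain ⟨d, hd, h₁, h₂⟩ := p.exists_boundary_dart X hs ht
  exact ⟨d.snd, ⟨h₂, d.fst, h₁, d.adj⟩, p.dart_snd_mem_support_of_mem_darts hd⟩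

theorem kappa_le_ncard_bdry {W : Type*} {G : SimpleGraph W} {X : Set W} {s t : W}
    (hs : s ∈ X) (ht : t ∈ nstar G X) : kappa G s t ≤ (bdry G X).ncard :=
  Nat.sInf_le ⟨bdry G X, rfl, fun h => h.1 hs, fun h => ht (Or.inr h),
    fun p => exists_mem_bdry_support p hs (mem_nstar.1 ht).1⟩

theorem IsSep.symm {W : Type*} {G : SimpleGraph W} {s t : W} {C : Set W} (h : IsSep G s t C) :
    IsSep G t s C :=
  ⟨h.2.1, h.1, fun p => by simpa using h.2.2 p.reverse⟩

theorem kappa_comm {W : Type*} (G : SimpleGraph W) (s t : W) : kappa G s t = kappa G t s := by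
  have h : ∀ C, IsSep G s t C ↔ IsSep G t s C := fun C => ⟨IsSep.symm, IsSep.symm⟩
  simp only [kappa, h]

theorem ncard_add_ncard_le_of_union_inter {W : Type*} [Finite W] {P Q C D : Set W}
    (hu : P ∪ Q ⊆ C ∪ D) (hi : P ∩ Q ⊆ C ∩ D) :
    P.ncard + Q.ncard ≤ C.ncard + D.ncard := by
  rw [← ncard_union_add_ncard_inter P Q, ← ncard_union_add_ncard_inter C D]
  exact Nat.add_le_add (ncard_le_ncard hu) (ncard_le_ncard hi)

theorem ncard_bdry_inter_add_union_le {W : Type*} [Finite W] (G : SimpleGraph W) (A B : Set W) :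
    (bdry G (A ∩ B)).ncard + (bdry G (A ∪ B)).ncard ≤
      (bdry G A).ncard + (bdry G B).ncard := by
  apply ncard_add_ncard_le_of_union_inter <;> intro v <;>
    simp only [mem_union, mem_inter_iff, mem_bdry] <;> grind

theorem ncard_bdry_inter_nstar_add_le {W : Type*} [Finite W] (G : SimpleGraph W) (A B : Set W) :
    (bdry G (nstar G A ∩ B)).ncard + (bdry G (nstar G B ∩ A)).ncard ≤
      (bdry G A).ncard + (bdry G B).ncard := by
  apply ncard_add_ncard_le_of_union_inter <;> intro v <;>
    simp only [mem_union, mem_inter_iff, mem_bdry, mem_nstar] <;>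
    grind [SimpleGraph.adj_comm]

theorem stmt15 (G : SimpleGraph V) (s a b : V)
    (hsa : ¬ G.Adj s a) (hsb : ¬ G.Adj s b) (hna : s ≠ a) (hnb : s ≠ b)
    (hk : kappa G s b ≤ kappa G s a)
    (A B RAS RBS : Set V)
    (hA : TightST G s a A ∧ ∀ X : Set V, TightST G s a X → A ⊆ X)
    (hB : TightST G s b B ∧ ∀ X : Set V, TightST G s b X → B ⊆ X)
    (hRAS : TightST G a s RAS ∧ ∀ X : Set V, TightST G a s X → RAS ⊆ X)
    (hRBS : TightST G b s RBS ∧ ∀ X : Set V, TightST G b s X → RBS ⊆ X) :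
    A ⊆ B ∨ (RAS ⊆ nstar G A ∩ B ∧ RBS ⊆ nstar G B ∩ A) ∨
      (a ∈ bdry G B ∨ b ∈ bdry G A) := by
  obtain ⟨⟨hsA, haA, hcA⟩, hminA⟩ := hA
  obtain ⟨⟨hsB, hbB, hcB⟩, hminB⟩ := hB
  by_cases haB : a ∈ bdry G B
  · exact Or.inr (Or.inr (Or.inl haB))
  by_cases hbA : b ∈ bdry G A
  · exact Or.inr (Or.inr (Or.inr hbA))
  by_cases hab : a ∈ B ∧ b ∈ A
  · have ha : a ∈ nstar G A ∩ B := ⟨haA, hab.1⟩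
    have hb : b ∈ nstar G B ∩ A := ⟨hbB, hab.2⟩
    have hsa' : s ∈ nstar G (nstar G A ∩ B) :=
      nstar_anti G inter_subset_left (subset_nstar_nstar G A hsA)
    have hsb' : s ∈ nstar G (nstar G B ∩ A) :=
      nstar_anti G inter_subset_left (subset_nstar_nstar G B hsB)
    have h₁ := kappa_le_ncard_bdry ha hsa'
    have h₂ := kappa_le_ncard_bdry hb hsb'
    have h₃ := ncard_bdry_inter_nstar_add_le G A B
    have h₄ := kappa_comm G s a
    have h₅ := kappa_comm G s b
    exact Or.inr (Or.inl ⟨hRAS.2 _ ⟨ha, hsa', by omega⟩, hRBS.2 _ ⟨hb, hsb', by omega⟩⟩)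
  · have hs : s ∈ A ∩ B := ⟨hsA, hsB⟩
    have ha : a ∈ nstar G (A ∩ B) := nstar_anti G inter_subset_left haA
    have h₁ := kappa_le_ncard_bdry hs ha
    have h₂ : kappa G s b ≤ (bdry G (A ∪ B)).ncard := by
      by_cases h : a ∈ B
      · exact kappa_le_ncard_bdry (Or.inl hsA)
          (mem_nstar_union (mem_nstar_of_notMem (fun hb => hab ⟨h, hb⟩) hbA) hbB)
      · exact hk.trans (kappa_le_ncard_bdry (Or.inl hsA)
          (mem_nstar_union haA (mem_nstar_of_notMem h haB)))
    have h₃ := ncard_bdry_inter_add_union_le G A B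
    exact Or.inl ((hminA _ ⟨hs, ha, by omega⟩).trans inter_subset_right)
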